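/- Let G be a finite simple graph of girth at least 5 (every cycle of G has length at least 5). Then G is very well-covered if and only if G has a perfect matching consisting entirely of pendant edges (equivalently, G is obtained from some graph H of girth at least 5 by attaching exactly one pendant vertex to each vertex of H). -/

import Mathlib

open Classical

variable {V : Type*} [Fintype V] [DecidableEq V]

/-- `S` is a stable (independent) set of vertices in `G`. -/
def IsStable (G : SimpleGraph V) (S : Finset V) : Prop :=
  ∀ ⦃x⦄, x ∈ S → ∀ ⦃y⦄, y ∈ S → ¬G.Adj x y

/-- The open neighborhood `N(S)`: vertices outside `S` having a neighbor in `S`. -/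
noncomputable def nbhd (G : SimpleGraph V) (S : Finset V) : Finset V :=
  Finset.univ.filter fun v => v ∉ S ∧ ∃ u ∈ S, G.Adj u v

/-- The closed neighborhood `N[S] = S ∪ N(S)`. -/
noncomputable def closedNbhd (G : SimpleGraph V) (S : Finset V) : Finset V :=
  S ∪ nbhd G S

/-- The stability (independence) number of the subgraph of `G` induced by `A`. -/
noncomputable def alphaOn (G : SimpleGraph V) (A : Finset V) : ℕ :=
  sSup {n | ∃ S ⊆ A, IsStable G S ∧ S.card = n}

/-- The stability (independence) number `α(G)`. -/
noncomputable def alpha (G : SimpleGraph V) : ℕ :=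
  alphaOn G Finset.univ

/-- `S` is a maximum stable set of the subgraph of `G` induced by `N[S]`. -/
def IsLocalMaxStable (G : SimpleGraph V) (S : Finset V) : Prop :=
  IsStable G S ∧ S.card = alphaOn G (closedNbhd G S)

/-- `Ψ(G)`: the family of all local maximum stable sets of `G`. -/
def Psi (G : SimpleGraph V) : Set (Finset V) :=
  {S | IsLocalMaxStable G S}

/-- A matching of `G`: a set of pairwise disjoint edges of `G`. -/
def IsGMatching (G : SimpleGraph V) (M : Finset (Sym2 V)) : Prop :=
  (∀ e ∈ M, e ∈ G.edgeSet) ∧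
    ∀ e ∈ M, ∀ f ∈ M, e ≠ f → ∀ v : V, v ∈ e → v ∉ f

/-- A matching of `G` all of whose edges have both endpoints inside `A`,
i.e. a matching of the subgraph of `G` induced by `A`. -/
def IsGMatchingOn (G : SimpleGraph V) (A : Finset V) (M : Finset (Sym2 V)) : Prop :=
  IsGMatching G M ∧ ∀ e ∈ M, ∀ v : V, v ∈ e → v ∈ A

/-- The matching number of the subgraph of `G` induced by `A`. -/
noncomputable def muOn (G : SimpleGraph V) (A : Finset V) : ℕ :=
  sSup {n | ∃ M, IsGMatchingOn G A M ∧ M.card = n}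

/-- The matching number `μ(G)`. -/
noncomputable def mu (G : SimpleGraph V) : ℕ :=
  muOn G Finset.univ

/-- A maximum matching of `G`. -/
def IsMaximumGMatching (G : SimpleGraph V) (M : Finset (Sym2 V)) : Prop :=
  IsGMatching G M ∧ M.card = mu G

/-- The matching `M` saturates the vertex `v`. -/
def MSaturates (M : Finset (Sym2 V)) (v : V) : Prop :=
  ∃ e ∈ M, v ∈ e

/-- A perfect matching of `G`: a matching saturating every vertex. -/
def IsPerfectGMatching (G : SimpleGraph V) (M : Finset (Sym2 V)) : Prop :=
  IsGMatching G M ∧ ∀ v : V, MSaturates M v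

/-- The set of vertices saturated by `M`. -/
noncomputable def msupp (M : Finset (Sym2 V)) : Finset V :=
  Finset.univ.filter fun v => ∃ e ∈ M, v ∈ e

/-- `M` is a uniquely restricted matching: it is the unique perfect matching of
the subgraph of `G` induced by the set of vertices saturated by `M`. -/
def UniquelyRestricted (G : SimpleGraph V) (M : Finset (Sym2 V)) : Prop :=
  IsGMatching G M ∧
    ∀ M' : Finset (Sym2 V), IsGMatchingOn G (msupp M) M' →
      (∀ v ∈ msupp M, MSaturates M' v) → M' = M

/-- Accessibility property of a set system. -/
def AccessibleFam (F : Set (Finset V)) : Prop :=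
  ∀ X ∈ F, X ≠ ∅ → ∃ x ∈ X, X.erase x ∈ F

/-- Exchange property of a set system. -/
def ExchangeFam (F : Set (Finset V)) : Prop :=
  ∀ X ∈ F, ∀ Y ∈ F, X.card = Y.card + 1 → ∃ x ∈ X, x ∉ Y ∧ insert x Y ∈ F

/-- A greedoid: a nonempty set system satisfying accessibility and exchange. -/
def IsGreedoidFam (F : Set (Finset V)) : Prop :=
  F.Nonempty ∧ AccessibleFam F ∧ ExchangeFam F

/-- A maximal stable set. -/
def IsMaximalStable (G : SimpleGraph V) (S : Finset V) : Prop :=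
  IsStable G S ∧ ∀ T, IsStable G T → S ⊆ T → S = T

/-- `G` is well-covered: all maximal stable sets have the same cardinality. -/
def WellCovered (G : SimpleGraph V) : Prop :=
  ∀ S T, IsMaximalStable G S → IsMaximalStable G T → S.card = T.card

/-- `G` is very well-covered: well-covered, no isolated vertices, `|V| = 2α(G)`. -/
def VeryWellCovered (G : SimpleGraph V) : Prop :=
  WellCovered G ∧ (∀ v : V, ∃ u, G.Adj v u) ∧ Fintype.card V = 2 * alpha G

/-- The subgraph of `G` induced by `A` is a König-Egerváry graph. -/
def KonigEgervaryOn (G : SimpleGraph V) (A : Finset V) : Prop :=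
  alphaOn G A + muOn G A = A.card

/-- `G` is a König-Egerváry graph: `α(G) + μ(G) = |V(G)|`. -/
def KonigEgervary (G : SimpleGraph V) : Prop :=
  alpha G + mu G = Fintype.card V

/-- The cycle `c` is alternating with respect to `M`: of every two incident
edges of `c` exactly one belongs to `M`. -/
def IsAlternatingCycle (G : SimpleGraph V) (M : Finset (Sym2 V)) {v : V}
    (c : G.Walk v v) : Prop :=
  c.IsCycle ∧ ∀ e ∈ c.edges, ∀ f ∈ c.edges, e ≠ f →
    (∃ u : V, u ∈ e ∧ u ∈ f) → (e ∈ M ↔ f ∉ M)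

/-- `G` contains an `M`-alternating cycle. -/
def HasAlternatingCycle (G : SimpleGraph V) (M : Finset (Sym2 V)) : Prop :=
  ∃ (v : V) (c : G.Walk v v), IsAlternatingCycle G M c

/-- The cycle `c` is chordless: the subgraph induced by its vertices has no
edges other than the cycle edges. -/
def ChordlessCycle (G : SimpleGraph V) {v : V} (c : G.Walk v v) : Prop :=
  ∀ x ∈ c.support, ∀ y ∈ c.support, G.Adj x y → s(x, y) ∈ c.edges

set_option linter.unusedSectionVars false

theorem IsStable.exists_maximal_superset {G : SimpleGraph V} {S : Finset V}
    (hS : IsStable G S) : ∃ T, S ⊆ T ∧ IsMaximalStable G T := by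
  obtain ⟨T, hST, hT⟩ := Finite.exists_le_maximal (p := IsStable G) hS
  exact ⟨T, hST, hT.prop, fun U hU hTU => hTU.antisymm (hT.le_of_ge hU hTU)⟩

theorem IsMaximalStable.card_eq_alpha {G : SimpleGraph V} (hG : WellCovered G) {T : Finset V}
    (hT : IsMaximalStable G T) : T.card = alpha G := by
  have hmem : T.card ∈ {n | ∃ S ⊆ Finset.univ, IsStable G S ∧ S.card = n} :=
    ⟨T, T.subset_univ, hT.1, rfl⟩
  refine (IsGreatest.csSup_eq ⟨hmem, ?_⟩).symm
  rintro n ⟨S, -, hS, rfl⟩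
  obtain ⟨U, hSU, hU⟩ := hS.exists_maximal_superset
  exact (Finset.card_le_card hSU).trans (hG U T hU hT).le

theorem IsStable.mono {G : SimpleGraph V} {S T : Finset V} (hT : IsStable G T) (h : S ⊆ T) :
    IsStable G S :=
  fun _ hx _ hy => hT (h hx) (h hy)

theorem isStable_singleton (G : SimpleGraph V) (v : V) : IsStable G {v} := by
  intro x hx y hy
  rw [Finset.mem_singleton] at hx hy
  subst hx hy
  exact G.irrefl

theorem isStable_pair {G : SimpleGraph V} {a b : V} (h : ¬G.Adj a b) : IsStable G {a, b} := by
  intro x hx y hy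
  simp only [Finset.mem_insert, Finset.mem_singleton] at hx hy
  rcases hx with rfl | rfl <;> rcases hy with rfl | rfl
  · exact G.irrefl
  · exact h
  · exact fun h' => h h'.symm
  · exact G.irrefl

theorem mem_nbhd {G : SimpleGraph V} {S : Finset V} {v : V} :
    v ∈ nbhd G S ↔ v ∉ S ∧ ∃ u ∈ S, G.Adj u v := by
  simp [nbhd]

/-- In a well-covered graph without isolated vertices, stable sets satisfy Hall's condition. -/
theorem WellCovered.card_le_card_nbhd {G : SimpleGraph V} (hG : WellCovered G)
    (hiso : ∀ v : V, ∃ u, G.Adj v u) {A : Finset V} (hA : IsStable G A) :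
    A.card ≤ (nbhd G A).card := by
  induction A using Finset.strongInduction with
  | H A ih =>
    rcases A.eq_empty_or_nonempty with rfl | ⟨x, hx⟩
    · simp
    obtain ⟨y, hxy⟩ := hiso x
    obtain ⟨T, hyT, hT⟩ := (isStable_singleton G y).exists_maximal_superset
    rw [Finset.singleton_subset_iff] at hyT
    have hxT : x ∉ T := fun h => hT.1 h hyT hxy
    have hind : (A ∩ T).card ≤ (nbhd G (A ∩ T)).card := by
      refine ih _ ?_ (hA.mono Finset.inter_subset_left)
      refine Finset.ssubset_iff_subset_ne.2 ⟨Finset.inter_subset_left, fun h => hxT ?_⟩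
      exact (Finset.mem_inter.1 (h ▸ hx)).2
    have hexch : (A \ T).card ≤ (T ∩ nbhd G A).card := by
      have hstable : IsStable G ((T \ nbhd G A) ∪ A) := by
        have key : ∀ v ∈ T \ nbhd G A, ∀ a ∈ A, ¬G.Adj a v := by
          intro v hv a ha hav
          refine (Finset.mem_sdiff.1 hv).2 (mem_nbhd.2 ⟨fun hvA => hA ha hvA hav, a, ha, hav⟩)
        intro v hv w hw hvw
        rcases Finset.mem_union.1 hv with hv | hv <;> rcases Finset.mem_union.1 hw with hw | hw
        · exact hT.1 (Finset.mem_sdiff.1 hv).1 (Finset.mem_sdiff.1 hw).1 hvw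
        · exact key v hv w hw hvw.symm
        · exact key w hw v hv hvw
        · exact hA hv hw hvw
      obtain ⟨U, hU, hUmax⟩ := hstable.exists_maximal_superset
      have h₁ := (Finset.card_le_card hU).trans (hG U T hUmax hT).le
      have h₂ : (T \ nbhd G A) ∪ A = (T \ nbhd G A) ∪ (A \ T) := by
        ext v
        by_cases hv : v ∈ A <;> simp [hv, mem_nbhd, Decidable.em]
      rw [h₂, Finset.card_union_of_disjoint] at h₁
      · have := Finset.card_sdiff_add_card_inter T (nbhd G A)
        omega
      · exact Finset.disjoint_left.2 fun v hv hv' =>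
          (Finset.mem_sdiff.1 hv').2 (Finset.mem_sdiff.1 hv).1
    have hdisj : Disjoint (nbhd G (A ∩ T)) (T ∩ nbhd G A) := by
      refine Finset.disjoint_left.2 fun v hv hv' => ?_
      obtain ⟨-, u, hu, huv⟩ := mem_nbhd.1 hv
      exact hT.1 (Finset.mem_inter.1 hu).2 (Finset.mem_inter.1 hv').1 huv
    have hsub : nbhd G (A ∩ T) ∪ (T ∩ nbhd G A) ⊆ nbhd G A := by
      refine Finset.union_subset (fun v hv => ?_) Finset.inter_subset_right
      obtain ⟨-, u, hu, huv⟩ := mem_nbhd.1 hv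
      have huA := (Finset.mem_inter.1 hu).1
      exact mem_nbhd.2 ⟨fun hvA => hA huA hvA huv, u, huA, huv⟩
    have h₁ := Finset.card_le_card hsub
    rw [Finset.card_union_of_disjoint hdisj] at h₁
    have := Finset.card_sdiff_add_card_inter A T
    omega

theorem WellCovered.exists_injective_adj {G : SimpleGraph V} (hG : WellCovered G)
    (hiso : ∀ v : V, ∃ u, G.Adj v u) {S : Finset V} (hS : IsStable G S) :
    ∃ f : S → V, Function.Injective f ∧ ∀ x : S, G.Adj x (f x) := by
  obtain ⟨f, hf, hadj⟩ := (Finset.all_card_le_biUnion_card_iff_exists_injective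
    (fun x : S => Finset.univ.filter fun v => G.Adj x v)).1 (fun A => by
      have hA : IsStable G (A.map (Function.Embedding.subtype _)) :=
        hS.mono fun v hv => by
          obtain ⟨a, -, rfl⟩ := Finset.mem_map.1 hv
          exact a.2
      have h := hG.card_le_card_nbhd hiso hA
      rw [Finset.card_map] at h
      refine h.trans (Finset.card_le_card fun v hv => ?_)
      obtain ⟨-, u, hu, huv⟩ := mem_nbhd.1 hv
      obtain ⟨a, ha, rfl⟩ := Finset.mem_map.1 hu
      exact Finset.mem_biUnion.2 ⟨a, ha, Finset.mem_filter.2 ⟨Finset.mem_univ _, huv⟩⟩)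
  exact ⟨f, hf, fun x => (Finset.mem_filter.1 (hadj x)).2⟩

/-- A matching of a stable set `S` onto its complement meets every stable set `T` of the same
cardinality in each of its edges. -/
theorem IsStable.mem_or_apply_mem {G : SimpleGraph V} {S T : Finset V} (hT : IsStable G T)
    (hcard : S.card ≤ T.card) {f : S → V} (hf : ∀ x : S, G.Adj x (f x))
    (hsurj : ∀ v ∉ S, ∃ x, f x = v) (x : S) : (x : V) ∈ T ∨ f x ∈ T := by
  by_contra! hx
  have hsub : T ⊆ (Finset.univ.erase x).image fun s : S =>
      if (s : V) ∈ T then (s : V) else f s := by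
    intro v hv
    rw [Finset.mem_image]
    by_cases hvS : v ∈ S
    · refine ⟨⟨v, hvS⟩, Finset.mem_erase.2 ⟨?_, Finset.mem_univ _⟩, by simp [hv]⟩
      rintro rfl
      exact hx.1 hv
    · obtain ⟨s, rfl⟩ := hsurj v hvS
      have hs : (s : V) ∉ T := fun h => hT h hv (hf s)
      refine ⟨s, Finset.mem_erase.2 ⟨?_, Finset.mem_univ _⟩, by simp [hs]⟩
      rintro rfl
      exact hx.2 hv
  have h := (Finset.card_le_card hsub).trans Finset.card_image_le
  rw [Finset.card_erase_of_mem (Finset.mem_univ x), Finset.card_univ, Fintype.card_coe] at h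
  have : 0 < S.card := Finset.card_pos.2 ⟨x, x.2⟩
  omega

theorem not_adj_of_girth_ge_five {G : SimpleGraph V}
    (hg : ∀ (v : V) (c : G.Walk v v), c.IsCycle → 5 ≤ c.length) {x y a b : V}
    (hxy : G.Adj x y) (hxa : G.Adj x a) (hyb : G.Adj y b) (hay : a ≠ y) (hbx : b ≠ x) :
    ¬G.Adj a b := by
  intro hab
  have h := hg x (.cons hxy (.cons hyb (.cons hab.symm (.cons hxa.symm .nil)))) (by
    have := hxy.ne
    have := hxa.ne
    have := hyb.ne
    have := hab.ne
    rw [SimpleGraph.Walk.isCycle_def, SimpleGraph.Walk.isTrail_def]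
    simp
    grind)
  simp at h

theorem VeryWellCovered.exists_pendant_perfect_matching {G : SimpleGraph V}
    (hg : ∀ (v : V) (c : G.Walk v v), c.IsCycle → 5 ≤ c.length) (hG : VeryWellCovered G) :
    ∃ M : Finset (Sym2 V), IsPerfectGMatching G M ∧
      ∀ e ∈ M, ∃ x y : V, e = s(x, y) ∧ G.neighborSet x = {y} := by
  obtain ⟨hwc, hiso, hn⟩ := hG
  have hempty : IsStable G ∅ := fun x hx => by simp at hx
  obtain ⟨S, -, hS⟩ := hempty.exists_maximal_superset
  have hScard := hS.card_eq_alpha hwc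
  obtain ⟨f, hinj, hadj⟩ := hwc.exists_injective_adj hiso hS.1
  have hfS : ∀ x, f x ∉ S := fun x h => hS.1 x.2 h (hadj x)
  have hsurj : ∀ v ∉ S, ∃ x, f x = v := by
    have heq : Finset.univ.image f = Sᶜ := by
      refine Finset.eq_of_subset_of_card_le (fun v hv => ?_) ?_
      · obtain ⟨x, -, rfl⟩ := Finset.mem_image.1 hv
        exact Finset.mem_compl.2 (hfS x)
      · rw [Finset.card_image_of_injective _ hinj, Finset.card_compl, Finset.card_univ,
          Fintype.card_coe]
        omega
    intro v hv
    obtain ⟨x, -, hx⟩ := Finset.mem_image.1 (heq ▸ Finset.mem_compl.2 hv)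
    exact ⟨x, hx⟩
  have hmeet : ∀ T, IsStable G T → ∀ x : S,
      ∃ U, T ⊆ U ∧ IsStable G U ∧ ((x : V) ∈ U ∨ f x ∈ U) := by
    intro T hT x
    obtain ⟨U, hTU, hU⟩ := hT.exists_maximal_superset
    exact ⟨U, hTU, hU.1, hU.1.mem_or_apply_mem (hwc S U hS hU).le hadj hsurj x⟩
  refine ⟨Finset.univ.image fun x : S => s((x : V), f x), ⟨⟨?_, ?_⟩, ?_⟩, ?_⟩
  · intro e he
    obtain ⟨x, -, rfl⟩ := Finset.mem_image.1 he
    exact hadj x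
  · intro e he e' he' hne v hv hv'
    obtain ⟨x, -, rfl⟩ := Finset.mem_image.1 he
    obtain ⟨x', -, rfl⟩ := Finset.mem_image.1 he'
    have hxx' : x ≠ x' := by rintro rfl; exact hne rfl
    rcases Sym2.mem_iff.1 hv with rfl | rfl <;> rcases Sym2.mem_iff.1 hv' with h | h
    · exact hxx' (Subtype.ext h)
    · exact hfS x' (h ▸ x.2)
    · exact hfS x (h ▸ x'.2)
    · exact hxx' (hinj h)
  · intro v
    by_cases hv : v ∈ S
    · exact ⟨_, Finset.mem_image_of_mem _ (Finset.mem_univ ⟨v, hv⟩), Sym2.mem_mk_left _ _⟩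
    · obtain ⟨x, rfl⟩ := hsurj v hv
      exact ⟨_, Finset.mem_image_of_mem _ (Finset.mem_univ x), Sym2.mem_mk_right _ _⟩
  · intro e he
    obtain ⟨x, -, rfl⟩ := Finset.mem_image.1 he
    by_cases hx : ∃ a, G.Adj x a ∧ a ≠ f x
    · obtain ⟨a, hxa, hay⟩ := hx
      refine ⟨f x, x, Sym2.eq_swap, Set.eq_singleton_iff_unique_mem.2 ⟨(hadj x).symm, ?_⟩⟩
      intro b hyb
      by_contra hbx
      obtain ⟨U, hU, hUst, hxU⟩ := hmeet {a, b}
        (isStable_pair (not_adj_of_girth_ge_five hg (hadj x) hxa hyb hay hbx)) x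
      rcases hxU with h | h
      · exact hUst h (hU (by simp)) hxa
      · exact hUst h (hU (by simp)) hyb
    · push Not at hx
      exact ⟨x, f x, rfl, Set.eq_singleton_iff_unique_mem.2 ⟨hadj x, hx⟩⟩

theorem veryWellCovered_of_pendant_perfect_matching {G : SimpleGraph V} {M : Finset (Sym2 V)}
    (hM : IsPerfectGMatching G M)
    (hpend : ∀ e ∈ M, ∃ x y : V, e = s(x, y) ∧ G.neighborSet x = {y}) : VeryWellCovered G := by
  obtain ⟨⟨hedge, hdisj⟩, hsat⟩ := hM
  choose m hmM hmem using hsat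
  have hm : ∀ e ∈ M, ∀ v ∈ e, m v = e := by
    intro e he v hv
    by_contra hne
    exact hdisj _ (hmM v) e he hne v (hmem v) hv
  have hcard : ∀ T, IsMaximalStable G T → T.card = M.card := by
    intro T hT
    refine Finset.card_bij (fun v _ => m v) (fun v _ => hmM v) ?_ ?_
    · intro v hv w hw hvw
      by_contra hne
      have he : m v = s(v, w) := (Sym2.mem_and_mem_iff hne).1 ⟨hmem v, hvw ▸ hmem w⟩
      exact hT.1 hv hw (he ▸ hedge _ (hmM v) : s(v, w) ∈ G.edgeSet)
    · intro e he
      obtain ⟨x, y, rfl, hx⟩ := hpend e he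
      by_cases hy : y ∈ T
      · exact ⟨y, hy, hm _ he y (Sym2.mem_mk_right _ _)⟩
      refine ⟨x, ?_, hm _ he x (Sym2.mem_mk_left _ _)⟩
      have hnadj : ∀ w ∈ T, ¬G.Adj x w := by
        intro w hw hxw
        have : w ∈ G.neighborSet x := hxw
        rw [hx, Set.mem_singleton_iff] at this
        exact hy (this ▸ hw)
      have hins : IsStable G (insert x T) := by
        intro v hv w hw hvw
        rw [Finset.mem_insert] at hv hw
        rcases hv with rfl | hv <;> rcases hw with rfl | hw
        · exact G.irrefl hvw
        · exact hnadj w hw hvw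
        · exact hnadj v hv hvw.symm
        · exact hT.1 hv hw hvw
      rw [hT.2 _ hins (Finset.subset_insert x T)]
      exact Finset.mem_insert_self x T
  have hwc : WellCovered G := fun S T hS hT => (hcard S hS).trans (hcard T hT).symm
  refine ⟨hwc, fun v => ?_, ?_⟩
  · obtain ⟨u, hu⟩ := hmem v
    exact ⟨u, (hu ▸ hedge _ (hmM v) : s(v, u) ∈ G.edgeSet)⟩
  · have hempty : IsStable G ∅ := fun x hx => by simp at hx
    obtain ⟨T, -, hT⟩ := hempty.exists_maximal_superset
    rw [← hT.card_eq_alpha hwc, hcard T hT, ← Finset.card_univ,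
      Finset.card_eq_sum_card_fiberwise (f := m) (t := M) (fun v _ => hmM v),
      Finset.sum_const_nat (m := 2), mul_comm]
    intro e he
    obtain ⟨x, y, rfl, -⟩ := hpend e he
    have hxy : x ≠ y := G.ne_of_adj (hedge _ he)
    rw [← Finset.card_pair hxy]
    congr 1
    ext v
    simp only [Finset.mem_filter, Finset.mem_univ, true_and, Finset.mem_insert,
      Finset.mem_singleton, ← Sym2.mem_iff]
    exact ⟨fun h => h ▸ hmem v, hm _ he v⟩

/-- A graph of girth at least 5 is very well-covered iff it has a
perfect matching consisting entirely of pendant edges. -/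
theorem girth_ge_five_vwc_iff_pendant_perfect_matching (G : SimpleGraph V)
    (hg : ∀ (v : V) (c : G.Walk v v), c.IsCycle → 5 ≤ c.length) :
    VeryWellCovered G ↔
      ∃ M : Finset (Sym2 V), IsPerfectGMatching G M ∧
        ∀ e ∈ M, ∃ x y : V, e = s(x, y) ∧ G.neighborSet x = {y} :=
  ⟨fun h => h.exists_pendant_perfect_matching hg,
    fun ⟨_, hM, hpend⟩ => veryWellCovered_of_pendant_perfect_matching hM hpend⟩
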